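/- arXiv:1202.2115 — 7 statements merged into one kernel-verified Lean document; each statement's English description precedes it below -/
import Mathlib

section
/- For every real t and every real δ with -1/2 < δ < 1/2, setting s = 1/2 + δ + i t, one has π^{-s/2}·Γ(s/2)·ζ(s) = 2·∫_0^∞ cos(((t - iδ)/2)·y)·Ω(y) dy − 1/((t - iδ)² + 1/4), where cos denotes the complex cosine and the integral converges absolutely. -/
open MeasureTheory Real Complex Set

/-- `Ω(y) = exp(y/4) · ∑_{n=1}^∞ exp(-π n² exp(y))`. -/
noncomputable def OmegaFun (y : ℝ) : ℝ :=
  Real.exp (y / 4) * ∑' n : ℕ, Real.exp (-π * ((n : ℝ) + 1) ^ 2 * Real.exp y)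

open HurwitzZeta in
lemma aux_fmodif_pos {y : ℝ} (hy : 0 < y) :
    (hurwitzEvenFEPair 0).f_modif (Real.exp y) =
      ((2 * ∑' n : ℕ, Real.exp (-π * ((n : ℝ) + 1) ^ 2 * Real.exp y) : ℝ) : ℂ) := by
  have h1 : (1 : ℝ) < Real.exp y := Real.one_lt_exp_iff.mpr hy
  have h2 := (hasSum_nat_cosKernel₀ 0 (Real.exp_pos y)).tsum_eq
  simp only [mul_zero, zero_mul, Real.cos_zero, mul_one, tsum_mul_left] at h2
  rw [h2, WeakFEPair.f_modif, Pi.add_apply, indicator_of_mem (mem_Ioi.mpr h1),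
    indicator_of_notMem (notMem_Ioo_of_ge h1.le)]
  simp [hurwitzEvenFEPair, evenKernel_eq_cosKernel_of_zero]

open HurwitzZeta in
lemma aux_fmodif_neg {y : ℝ} (hy : 0 < y) :
    (hurwitzEvenFEPair 0).f_modif (Real.exp (-y)) =
      Complex.exp (y / 2) *
      ((2 * ∑' n : ℕ, Real.exp (-π * ((n : ℝ) + 1) ^ 2 * Real.exp y) : ℝ) : ℂ) := by
  have h := (hurwitzEvenFEPair 0).hf_modif_FE (Real.exp y) (Real.exp_pos y)
  have hg : (hurwitzEvenFEPair 0).g_modif = (hurwitzEvenFEPair 0).f_modif := by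
    change (hurwitzEvenFEPair 0).symm.f_modif = _
    rw [hurwitzEvenFEPair_zero_symm]
  rw [hg, aux_fmodif_pos hy] at h
  rw [Real.exp_neg, ← one_div, h, smul_eq_mul]
  congr 1
  change (1 : ℂ) * ((Real.exp y ^ (1 / 2 : ℝ) : ℝ) : ℂ) = _
  rw [← Real.exp_mul]
  push_cast
  rw [one_mul]
  congr 1
  ring

lemma aux_cexp (x : ℝ) (s : ℂ) (f : ℂ) :
    Real.exp x • (((Real.exp x : ℝ) : ℂ) ^ (s - 1) • f) = Complex.exp (s * x) * f := by
  change ((Real.exp x : ℝ) : ℂ) * (((Real.exp x : ℝ) : ℂ) ^ (s - 1) * f) = _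
  rw [← mul_assoc, Complex.ofReal_exp, Complex.cpow_def_of_ne_zero (Complex.exp_ne_zero _),
    ← Complex.ofReal_exp, ← Complex.ofReal_log (Real.exp_pos x).le, Real.log_exp,
    Complex.ofReal_exp, ← Complex.exp_add]
  congr 2
  ring

lemma aux_image : Real.exp '' univ = Ioi 0 := by rw [Set.image_univ, Real.range_exp]

lemma aux_main (F : ℝ → ℂ) (s : ℂ) (hF : MellinConvergent F s) :
    IntegrableOn (fun y : ℝ => Complex.exp (s * y) * F (Real.exp y)
      + Complex.exp (-(s * y)) * F (Real.exp (-y))) (Ioi 0) ∧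
    mellin F s = ∫ y in Ioi (0 : ℝ), (Complex.exp (s * y) * F (Real.exp y)
      + Complex.exp (-(s * y)) * F (Real.exp (-y))) := by
  set h : ℝ → ℂ := fun y => Complex.exp (s * y) * F (Real.exp y) with hh
  have hint : Integrable h := by
    rw [MellinConvergent, ← aux_image, integrableOn_image_iff_integrableOn_abs_deriv_smul
      MeasurableSet.univ (fun x _ => (Real.hasDerivAt_exp x).hasDerivWithinAt)
      Real.exp_injective.injOn, integrableOn_univ] at hF
    simpa only [abs_of_pos (Real.exp_pos _), aux_cexp] using hF
  have hmel : mellin F s = ∫ y, h y := by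
    rw [mellin, ← aux_image, integral_image_eq_integral_abs_deriv_smul
      MeasurableSet.univ (fun x _ => (Real.hasDerivAt_exp x).hasDerivWithinAt)
      Real.exp_injective.injOn, setIntegral_univ]
    simp only [abs_of_pos (Real.exp_pos _), aux_cexp, hh]
  have hneg : ∀ y : ℝ, Complex.exp (-(s * y)) * F (Real.exp (-y)) = h (-y) := by
    intro y; simp [hh]
  simp only [hneg]
  have hint' : Integrable (fun y => h (-y)) := hint.comp_neg
  refine ⟨(hint.add hint').integrableOn, ?_⟩
  rw [integral_add hint.integrableOn hint'.integrableOn, integral_comp_neg_Ioi, neg_zero, hmel,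
    ← integral_add_compl (s := Ioi 0) measurableSet_Ioi hint, compl_Ioi]

open HurwitzZeta in
theorem stmt_1 (t δ : ℝ) (hδ1 : -(1 / 2) < δ) (hδ2 : δ < 1 / 2) :
    IntegrableOn
      (fun y : ℝ => Complex.cos (((t : ℂ) - Complex.I * δ) / 2 * y) * (OmegaFun y : ℂ))
      (Ioi 0) ∧
    (π : ℂ) ^ (-(1 / 2 + (δ : ℂ) + Complex.I * t) / 2) *
        Complex.Gamma ((1 / 2 + (δ : ℂ) + Complex.I * t) / 2) *
        riemannZeta (1 / 2 + (δ : ℂ) + Complex.I * t) =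
      2 * (∫ y in Ioi (0 : ℝ),
            Complex.cos (((t : ℂ) - Complex.I * δ) / 2 * y) * (OmegaFun y : ℂ))
        - 1 / (((t : ℂ) - Complex.I * δ) ^ 2 + 1 / 4) := by
  set s : ℂ := 1 / 2 + (δ : ℂ) + Complex.I * t with hs
  have hre : s.re = 1 / 2 + δ := by simp [hs]
  obtain ⟨h1, h2⟩ := aux_main (hurwitzEvenFEPair 0).f_modif (s / 2)
    ((hurwitzEvenFEPair 0).isStrongFEPair_toStrongFEPair.hasMellin (s / 2)).1
  have key : EqOn (fun y : ℝ => Complex.exp (s / 2 * y) * (hurwitzEvenFEPair 0).f_modif (Real.exp y)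
      + Complex.exp (-(s / 2 * y)) * (hurwitzEvenFEPair 0).f_modif (Real.exp (-y)))
      (fun y : ℝ => 4 * (Complex.cos (((t : ℂ) - Complex.I * δ) / 2 * y) * (OmegaFun y : ℂ)))
      (Ioi 0) := by
    intro y hy
    simp only
    rw [aux_fmodif_pos hy, aux_fmodif_neg hy, OmegaFun, Complex.cos]
    generalize (∑' n : ℕ, Real.exp (-π * ((n : ℝ) + 1) ^ 2 * Real.exp y)) = S
    have e1 : Complex.exp (s / 2 * y) = Complex.exp (((t : ℂ) - Complex.I * δ) / 2 * y * Complex.I)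
        * Complex.exp (y / 4) := by
      rw [← Complex.exp_add]; congr 1; rw [hs]; linear_combination (δ / 2 * y : ℂ) * Complex.I_sq
    have e2 : Complex.exp (-(s / 2 * y)) * Complex.exp (y / 2) =
        Complex.exp (-(((t : ℂ) - Complex.I * δ) / 2 * y) * Complex.I) * Complex.exp (y / 4) := by
      rw [← Complex.exp_add, ← Complex.exp_add]; congr 1; rw [hs]
      linear_combination (-δ / 2 * y : ℂ) * Complex.I_sq
    rw [← mul_assoc, e1, e2]
    push_cast
    ring
  rw [integrableOn_congr_fun key measurableSet_Ioi] at h1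
  rw [setIntegral_congr_fun measurableSet_Ioi key, integral_const_mul] at h2
  constructor
  · have := h1.const_mul (1 / 4)
    refine this.congr (Filter.Eventually.of_forall fun y => ?_)
    simp only; ring
  · have hs0 : s ≠ 0 := by
      intro h; rw [h] at hre; simp at hre; linarith
    have hs1 : 1 - s ≠ 0 := by
      intro h
      have : s = 1 := (sub_eq_zero.mp h).symm
      rw [this] at hre; simp at hre; linarith
    have hG : Gammaℝ s ≠ 0 := Gammaℝ_ne_zero_of_re_pos (by rw [hre]; linarith)
    rw [← Gammaℝ_def, riemannZeta_def_of_ne_zero hs0, mul_div_cancel₀ _ hG, completedRiemannZeta_eq]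
    have h3 : completedRiemannZeta₀ s = mellin (hurwitzEvenFEPair 0).f_modif (s / 2) / 2 := rfl
    have h4 : ((t : ℂ) - Complex.I * δ) ^ 2 + 1 / 4 = s * (1 - s) := by
      rw [hs]; linear_combination (δ ^ 2 + t ^ 2 : ℂ) * Complex.I_sq
    rw [h3, h2, h4]
    field_simp
    ring
end

section
/- For every real t and every real δ with -1/2 < δ < 1/2, setting s = 1/2 + δ + i t, one has π^{-s/2}·Γ(s/2)·ζ(s) = 2·∫_0^∞ cos(((t - iδ)/2)·y)·Φ(y) dy, where cos denotes the complex cosine and the integral converges absolutely. -/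
open MeasureTheory Real Complex Set

/-- `Φ(y) = -(1/2)·(exp(-y/4) − 2·∑_{n=1}^∞ exp(y/4 − π n²·exp(y)))`. -/
noncomputable def PhiFun (y : ℝ) : ℝ :=
  -(1 / 2) * (Real.exp (-y / 4) -
    2 * ∑' n : ℕ, Real.exp (y / 4 - π * ((n : ℝ) + 1) ^ 2 * Real.exp y))

open HurwitzZeta in
lemma phi_sum (y : ℝ) :
    ∑' n : ℕ, Real.exp (y / 4 - π * ((n : ℝ) + 1) ^ 2 * Real.exp y) =
      Real.exp (y / 4) * ((cosKernel 0 (Real.exp y) - 1) / 2) := by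
  have h := hasSum_nat_cosKernel₀ 0 (Real.exp_pos y)
  have h2 := (h.div_const 2).mul_left (Real.exp (y / 4))
  rw [show ((0 : ℝ) : UnitAddCircle) = 0 from rfl] at h2
  rw [← h2.tsum_eq]
  congr 1
  ext n
  rw [Real.exp_sub]
  simp only [mul_zero, zero_mul, Real.cos_zero, neg_mul, Real.exp_neg]
  ring

open HurwitzZeta in
lemma modif_pos {y : ℝ} (hy : 0 < y) :
    (hurwitzEvenFEPair 0).f_modif (Real.exp y) = ((cosKernel 0 (Real.exp y) - 1 : ℝ) : ℂ) := by
  have h1 : 1 < Real.exp y := Real.one_lt_exp_iff.mpr hy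
  simp [WeakFEPair.f_modif, h1, h1.le, hurwitzEvenFEPair, evenKernel_eq_cosKernel_of_zero,
    not_lt.mpr h1.le]

open HurwitzZeta in
lemma modif_neg {y : ℝ} (hy : 0 < y) :
    (hurwitzEvenFEPair 0).f_modif (Real.exp (-y)) =
      cexp (y / 2) * ((cosKernel 0 (Real.exp y) - 1 : ℝ) : ℂ) := by
  have h := (hurwitzEvenFEPair 0).hf_modif_FE _ (Real.exp_pos y)
  rw [Real.exp_neg, ← one_div, h]
  have h1 : 1 < Real.exp y := Real.one_lt_exp_iff.mpr hy
  have h2 : (hurwitzEvenFEPair 0).g_modif (Real.exp y)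
      = ((cosKernel 0 (Real.exp y) - 1 : ℝ) : ℂ) := by
    simp [WeakFEPair.g_modif, h1, h1.le, hurwitzEvenFEPair, not_lt.mpr h1.le]
  have h3 : (((Real.exp y) ^ (hurwitzEvenFEPair 0).k : ℝ) : ℂ) = cexp (y / 2) := by
    change (((Real.exp y) ^ (1 / 2 : ℝ) : ℝ) : ℂ) = _
    rw [← Real.exp_mul]
    push_cast
    congr 1
    ring
  rw [h2, h3]
  change (1 * _) • _ = _
  rw [one_mul, smul_eq_mul]

open HurwitzZeta in
lemma mellin_exp (s : ℂ) :
    Integrable (fun y : ℝ => cexp (s * y) * (hurwitzEvenFEPair 0).f_modif (Real.exp y)) ∧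
    ∫ y : ℝ, cexp (s * y) * (hurwitzEvenFEPair 0).f_modif (Real.exp y) =
      (hurwitzEvenFEPair 0).Λ₀ s := by
  have hc : MellinConvergent (hurwitzEvenFEPair 0).f_modif s :=
    ((hurwitzEvenFEPair 0).isStrongFEPair_toStrongFEPair.hasMellin s).1
  have key : ∀ y : ℝ, |Real.exp y| • (((Real.exp y : ℝ) : ℂ) ^ (s - 1) •
      (hurwitzEvenFEPair 0).f_modif (Real.exp y)) =
      cexp (s * y) * (hurwitzEvenFEPair 0).f_modif (Real.exp y) := by
    intro y
    rw [abs_of_pos (Real.exp_pos y), Complex.real_smul, smul_eq_mul, ← mul_assoc,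
      Complex.cpow_def_of_ne_zero (by exact_mod_cast (Real.exp_pos y).ne'),
      ← Complex.ofReal_log (Real.exp_pos y).le, Real.log_exp, Complex.ofReal_exp,
      ← Complex.exp_add]
    congr 2
    ring
  have him : Real.exp '' univ = Ioi 0 := by rw [image_univ, Real.range_exp]
  have hd : ∀ x ∈ (univ : Set ℝ), HasDerivWithinAt Real.exp (Real.exp x) univ x :=
    fun x _ => (Real.hasDerivAt_exp x).hasDerivWithinAt
  have hi : InjOn Real.exp univ := Real.exp_injective.injOn
  constructor
  · have := (integrableOn_image_iff_integrableOn_abs_deriv_smul MeasurableSet.univ hd hi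
      (fun x : ℝ => (x : ℂ) ^ (s - 1) • (hurwitzEvenFEPair 0).f_modif x)).mp
      (by rw [him]; exact hc)
    simp only [key] at this
    exact integrableOn_univ.mp this
  · have := integral_image_eq_integral_abs_deriv_smul MeasurableSet.univ hd hi
      (fun x : ℝ => (x : ℂ) ^ (s - 1) • (hurwitzEvenFEPair 0).f_modif x)
    simp only [key] at this
    rw [him, setIntegral_univ] at this
    exact this.symm

open HurwitzZeta in
theorem stmt_3 (t δ : ℝ) (hδ1 : -(1 / 2) < δ) (hδ2 : δ < 1 / 2) :
    IntegrableOn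
      (fun y : ℝ => Complex.cos (((t : ℂ) - Complex.I * δ) / 2 * y) * (PhiFun y : ℂ))
      (Ioi 0) ∧
    (π : ℂ) ^ (-(1 / 2 + (δ : ℂ) + Complex.I * t) / 2) *
        Complex.Gamma ((1 / 2 + (δ : ℂ) + Complex.I * t) / 2) *
        riemannZeta (1 / 2 + (δ : ℂ) + Complex.I * t) =
      2 * ∫ y in Ioi (0 : ℝ),
            Complex.cos (((t : ℂ) - Complex.I * δ) / 2 * y) * (PhiFun y : ℂ) := by
  set s : ℂ := 1 / 2 + (δ : ℂ) + Complex.I * t with hs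
  have hre : s.re = 1 / 2 + δ := by simp [hs]
  have hs0 : s ≠ 0 := by
    intro h; rw [h] at hre; simp at hre; linarith
  have hs1 : 1 - s ≠ 0 := by
    intro h
    have : (1 - s).re = 0 := by rw [h]; simp
    simp [hre] at this; linarith
  obtain ⟨hG, hGi⟩ := mellin_exp (s / 2)
  set G : ℝ → ℂ := fun y : ℝ =>
    cexp (s / 2 * y) * (hurwitzEvenFEPair 0).f_modif (Real.exp y) with hGdef
  have hGn : Integrable (fun y => G (-y)) := hG.comp_neg
  have ha : (-(s / 2)).re < 0 := by simp [hre]; linarith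
  have hb : (-((1 - s) / 2)).re < 0 := by simp [hre]; linarith
  have hE1 := integrableOn_exp_mul_complex_Ioi ha 0
  have hE2 := integrableOn_exp_mul_complex_Ioi hb 0
  have hpt : ∀ y ∈ Ioi (0 : ℝ),
      (1 / 4 : ℂ) * ((G y + G (-y)) -
        (cexp (-(s / 2) * y) + cexp (-((1 - s) / 2) * y))) =
      Complex.cos (((t : ℂ) - Complex.I * δ) / 2 * y) * (PhiFun y : ℂ) := by
    intro y hy
    have hcos : Complex.cos (((t : ℂ) - Complex.I * δ) / 2 * y) =
        (cexp ((s - 1 / 2) / 2 * y) + cexp (-((s - 1 / 2) / 2 * y))) / 2 := by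
      rw [Complex.cos, add_comm (cexp ((s - 1 / 2) / 2 * y))]
      have e : ((t : ℂ) - Complex.I * δ) / 2 * y * Complex.I = (s - 1 / 2) / 2 * y := by
        rw [hs]; linear_combination (-(δ : ℂ) / 2 * y) * Complex.I_sq
      rw [neg_mul, e, add_comm]
    simp only [hGdef]
    rw [modif_pos hy, modif_neg hy, hcos, PhiFun, phi_sum]
    set c := cosKernel 0 (Real.exp y)
    push_cast
    have e1 : cexp (s / 2 * y) = cexp ((s - 1 / 2) / 2 * y) * cexp (y / 4) := by
      rw [← Complex.exp_add]; congr 1; ring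
    have e2 : cexp (s / 2 * -(y : ℂ)) =
        cexp (-((s - 1 / 2) / 2 * y)) * cexp (y / 4) * cexp (-(y / 2)) := by
      rw [← Complex.exp_add, ← Complex.exp_add]; congr 1; ring
    have e3 : cexp (-(s / 2) * y) = cexp (-((s - 1 / 2) / 2 * y)) * cexp (-y / 4) := by
      rw [← Complex.exp_add]; congr 1; ring
    have e4 : cexp (-((1 - s) / 2) * y) = cexp ((s - 1 / 2) / 2 * y) * cexp (-y / 4) := by
      rw [← Complex.exp_add]; congr 1; ring
    have e5 : cexp (-((y : ℂ) / 2)) * cexp (y / 2) = 1 := by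
      rw [← Complex.exp_add]; simp
    rw [e1, e2, e3, e4]
    linear_combination (1 / 4 * cexp (-((s - 1 / 2) / 2 * y)) * cexp (y / 4) * (c - 1)) * e5
  have hI1 : IntegrableOn (fun y => G y + G (-y)) (Ioi 0) :=
    hG.integrableOn.add hGn.integrableOn
  have hI2 : IntegrableOn (fun y : ℝ => cexp (-(s / 2) * y) + cexp (-((1 - s) / 2) * y)) (Ioi 0) :=
    hE1.add hE2
  refine ⟨IntegrableOn.congr_fun ((hI1.sub hI2).const_mul (1 / 4 : ℂ)) hpt measurableSet_Ioi, ?_⟩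
  rw [← setIntegral_congr_fun measurableSet_Ioi hpt, integral_const_mul, integral_sub hI1 hI2,
    integral_add hG.integrableOn hGn.integrableOn, integral_add hE1 hE2,
    integral_exp_mul_complex_Ioi ha, integral_exp_mul_complex_Ioi hb, integral_comp_neg_Ioi,
    neg_zero, add_comm (∫ x in Ioi (0 : ℝ), G x),
    intervalIntegral.integral_Iic_add_Ioi hG.integrableOn hG.integrableOn, hGi]
  have hΛ : completedRiemannZeta₀ s = (hurwitzEvenFEPair 0).Λ₀ (s / 2) / 2 := rfl
  have hne : (π : ℂ) ^ (-s / 2) * Complex.Gamma (s / 2) ≠ 0 :=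
    Gammaℝ_ne_zero_of_re_pos (by rw [hre]; linarith)
  rw [riemannZeta_eq_completedRiemannZeta₀ hs0, mul_div_cancel₀ _ hne, hΛ]
  simp only [ofReal_zero, mul_zero, Complex.exp_zero]
  field_simp
  ring
end

section
/- For every real k and every real λ with -1 < λ < 1, setting s = (1 + λ + i k)/2, the integral ∫_{-∞}^∞ R(x)·exp(-i·(k - iλ)·x) dx converges absolutely and equals -(1/2)·π^{-s/2}·Γ(s/2)·ζ(s). -/
open MeasureTheory Real Complex Set

/-- The Riemann wave function `R(x) = exp(-|x|) − 2·∑_{n=1}^∞ exp(|x| − π n²·exp(4|x|))`. -/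
noncomputable def riemannWave (x : ℝ) : ℝ :=
  Real.exp (-|x|) - 2 * ∑' n : ℕ, Real.exp (|x| - π * ((n : ℝ) + 1) ^ 2 * Real.exp (4 * |x|))

noncomputable def rwS (x : ℝ) : ℝ :=
  2 * ∑' n : ℕ, Real.exp (|x| - π * ((n : ℝ) + 1) ^ 2 * Real.exp (4 * |x|))

lemma rw_A (y : ℝ) (hy : 0 < y) :
    ((rwS y : ℝ) : ℂ) = Complex.exp y *
      (HurwitzZeta.hurwitzEvenFEPair 0).f_modif (Real.exp (4 * y)) := by
  have h1 : 1 < Real.exp (4 * y) := by rw [Real.one_lt_exp_iff]; linarith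
  have h2 := (HurwitzZeta.hasSum_nat_cosKernel₀ 0 (Real.exp_pos (4 * y))).tsum_eq
  have h3 : (HurwitzZeta.hurwitzEvenFEPair 0).f_modif (Real.exp (4 * y)) =
      ((HurwitzZeta.cosKernel (0 : ℝ) (Real.exp (4 * y)) - 1 : ℝ) : ℂ) := by
    rw [WeakFEPair.f_modif, Pi.add_apply, indicator_of_mem (mem_Ioi.mpr h1),
      indicator_of_notMem (notMem_Ioo_of_ge h1.le), add_zero]
    simp [HurwitzZeta.hurwitzEvenFEPair, HurwitzZeta.evenKernel_eq_cosKernel_of_zero]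
  rw [h3, ← h2, ← Complex.ofReal_exp, ← Complex.ofReal_mul, rwS, abs_of_pos hy,
    ← tsum_mul_left, ← tsum_mul_left]
  congr 1
  refine tsum_congr fun n => ?_
  rw [sub_eq_add_neg, Real.exp_add]
  simp
  ring

lemma rw_B (y : ℝ) :
    (HurwitzZeta.hurwitzEvenFEPair 0).f_modif (Real.exp (-4 * y)) = Complex.exp (2 * y) *
      (HurwitzZeta.hurwitzEvenFEPair 0).f_modif (Real.exp (4 * y)) := by
  have h := (HurwitzZeta.hurwitzEvenFEPair 0).hf_modif_FE (Real.exp (4 * y)) (Real.exp_pos _)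
  have hg : (HurwitzZeta.hurwitzEvenFEPair 0).g_modif =
      (HurwitzZeta.hurwitzEvenFEPair 0).f_modif := by
    conv_rhs => rw [← HurwitzZeta.hurwitzEvenFEPair_zero_symm]
    rfl
  have he : (HurwitzZeta.hurwitzEvenFEPair 0).ε = 1 := rfl
  have hk : (HurwitzZeta.hurwitzEvenFEPair 0).k = 1 / 2 := rfl
  rw [hg, he, hk, one_div, ← Real.exp_neg, ← Real.exp_mul, one_mul, smul_eq_mul] at h
  rw [neg_mul, h, Complex.ofReal_exp]
  congr 2
  push_cast
  ring

lemma rw_C (x : ℝ) (hx : x ≠ 0) :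
    ((rwS x : ℝ) : ℂ) = Complex.exp (-x) *
      (HurwitzZeta.hurwitzEvenFEPair 0).f_modif (Real.exp (-4 * x)) := by
  rcases lt_or_gt_of_ne hx with h | h
  · have := rw_A (-x) (by linarith)
    have e : rwS (-x) = rwS x := by simp [rwS]
    rw [e] at this
    rw [this]
    push_cast
    congr 3
    ring
  · rw [rw_A x h, rw_B x, ← mul_assoc, ← Complex.exp_add]
    congr 2
    ring

lemma rw_D (w : ℂ) : Integrable (fun x : ℝ => ((rwS x : ℝ) : ℂ) * Complex.exp (-w * x)) ∧
    ∫ x : ℝ, ((rwS x : ℝ) : ℂ) * Complex.exp (-w * x) =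
      completedRiemannZeta₀ ((1 + w) / 2) / 2 := by
  set P := HurwitzZeta.hurwitzEvenFEPair 0 with hP
  have hconv : MellinConvergent P.f_modif ((1 + w) / 2 / 2) :=
    (P.isStrongFEPair_toStrongFEPair.hasMellin ((1 + w) / 2 / 2)).1
  have hval : completedRiemannZeta₀ ((1 + w) / 2) = mellin P.f_modif ((1 + w) / 2 / 2) / 2 := rfl
  have himg : (fun x : ℝ => Real.exp (-4 * x)) '' univ = Ioi 0 := by
    ext t
    simp only [image_univ, mem_range, mem_Ioi]
    constructor
    · rintro ⟨y, rfl⟩; exact Real.exp_pos _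
    · intro ht
      exact ⟨-Real.log t / 4, by rw [show -4 * (-Real.log t / 4) = Real.log t by ring, Real.exp_log ht]⟩
  have hder : ∀ x ∈ (univ : Set ℝ), HasDerivWithinAt (fun x : ℝ => Real.exp (-4 * x))
      (Real.exp (-4 * x) * (-4)) univ x := by
    intro x _
    have := ((hasDerivAt_id x).const_mul (-4)).exp
    simpa using this
  have hinj : InjOn (fun x : ℝ => Real.exp (-4 * x)) univ := by
    intro a _ b _ h
    have := Real.exp_injective h
    linarith
  have hae : (fun x : ℝ => |Real.exp (-4 * x) * (-4)| •
      (((Real.exp (-4 * x) : ℝ) : ℂ) ^ ((1 + w) / 2 / 2 - 1) • P.f_modif (Real.exp (-4 * x))))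
      =ᵐ[volume] fun x : ℝ => 4 * (((rwS x : ℝ) : ℂ) * Complex.exp (-w * x)) := by
    filter_upwards [compl_mem_ae_iff.mpr (Subsingleton.measure_zero (s := {(0 : ℝ)}) (by simp) _)]
      with x (hx : x ≠ 0)
    have hne : ((Real.exp (-4 * x) : ℝ) : ℂ) ≠ 0 := by
      exact_mod_cast (Real.exp_pos _).ne'
    rw [rw_C x hx, abs_mul, abs_of_pos (Real.exp_pos _), Complex.cpow_def_of_ne_zero hne,
      ← Complex.ofReal_log (Real.exp_pos _).le, Real.log_exp, Complex.real_smul, smul_eq_mul,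
      Complex.ofReal_mul, Complex.ofReal_exp]
    have h4 : ((|(-4 : ℝ)| : ℝ) : ℂ) = 4 := by norm_num
    rw [h4]
    have : Complex.exp (((-4 * x : ℝ)) : ℂ) *
        Complex.exp (((-4 * x : ℝ) : ℂ) * ((1 + w) / 2 / 2 - 1)) =
        Complex.exp (-x) * Complex.exp (-w * x) := by
      rw [← Complex.exp_add, ← Complex.exp_add]
      congr 1; push_cast; ring
    linear_combination (4 * P.f_modif (Real.exp (-4 * x))) * this
  constructor
  · rw [MellinConvergent, ← himg, integrableOn_image_iff_integrableOn_abs_deriv_smul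
      MeasurableSet.univ hder hinj, integrableOn_univ] at hconv
    have := (hconv.congr hae).const_mul (1 / 4)
    refine this.congr (Filter.Eventually.of_forall fun x => ?_)
    ring_nf
  · rw [hval, mellin, ← himg, integral_image_eq_integral_abs_deriv_smul
      MeasurableSet.univ hder hinj, setIntegral_univ, integral_congr_ae hae,
      integral_const_mul]
    ring

lemma rw_E (w : ℂ) (h1 : -1 < w.re) (h2 : w.re < 1) :
    Integrable (fun x : ℝ => ((Real.exp (-|x|) : ℝ) : ℂ) * Complex.exp (-w * x)) ∧
    ∫ x : ℝ, ((Real.exp (-|x|) : ℝ) : ℂ) * Complex.exp (-w * x) = 1 / (1 + w) + 1 / (1 - w) := by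
  have ha : (-1 - w).re < 0 := by simp; linarith
  have hb : 0 < (1 - w).re := by simp; linarith
  have e1 : EqOn (fun x : ℝ => Complex.exp ((-1 - w) * x))
      (fun x : ℝ => ((Real.exp (-|x|) : ℝ) : ℂ) * Complex.exp (-w * x)) (Ioi 0) := by
    intro x hx
    simp only
    rw [abs_of_pos hx, Complex.ofReal_exp, ← Complex.exp_add]
    congr 1; push_cast; ring
  have e2 : EqOn (fun x : ℝ => Complex.exp ((1 - w) * x))
      (fun x : ℝ => ((Real.exp (-|x|) : ℝ) : ℂ) * Complex.exp (-w * x)) (Iic 0) := by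
    intro x hx
    simp only
    rw [abs_of_nonpos hx, Complex.ofReal_exp, ← Complex.exp_add]
    congr 1; push_cast; ring
  have i1 := (integrableOn_exp_mul_complex_Ioi ha 0).congr_fun e1 measurableSet_Ioi
  have i2 := (integrableOn_exp_mul_complex_Iic hb 0).congr_fun e2 measurableSet_Iic
  constructor
  · rw [← integrableOn_univ, ← Iic_union_Ioi (a := (0 : ℝ))]
    exact i2.union i1
  · rw [← intervalIntegral.integral_Iic_add_Ioi i2 i1, ← setIntegral_congr_fun measurableSet_Ioi e1,
      ← setIntegral_congr_fun measurableSet_Iic e2, integral_exp_mul_complex_Ioi ha,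
      integral_exp_mul_complex_Iic hb]
    have hne : (1 + w) ≠ 0 := by
      intro h; have := congrArg Complex.re h; simp at this; linarith
    rw [show (-1 - w) = -(1 + w) by ring, neg_div_neg_eq]
    simp
    ring

theorem stmt_4 (k lam : ℝ) (h1 : -1 < lam) (h2 : lam < 1) :
    Integrable
      (fun x : ℝ => (riemannWave x : ℂ) *
        Complex.exp (-Complex.I * ((k : ℂ) - Complex.I * lam) * x)) ∧
    (∫ x : ℝ, (riemannWave x : ℂ) *
        Complex.exp (-Complex.I * ((k : ℂ) - Complex.I * lam) * x)) =
      -(1 / 2) * ((π : ℂ) ^ (-((1 + (lam : ℂ) + Complex.I * k) / 2) / 2) *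
        Complex.Gamma (((1 + (lam : ℂ) + Complex.I * k) / 2) / 2) *
        riemannZeta ((1 + (lam : ℂ) + Complex.I * k) / 2)) := by
  set w : ℂ := (lam : ℂ) + Complex.I * k with hw
  have hre : w.re = lam := by simp [hw]
  obtain ⟨d1, d2⟩ := rw_D w
  obtain ⟨c1, c2⟩ := rw_E w (by rw [hre]; exact h1) (by rw [hre]; exact h2)
  have hfun : (fun x : ℝ => (riemannWave x : ℂ) *
        Complex.exp (-Complex.I * ((k : ℂ) - Complex.I * lam) * x)) =
      fun x : ℝ => ((Real.exp (-|x|) : ℝ) : ℂ) * Complex.exp (-w * x) -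
        ((rwS x : ℝ) : ℂ) * Complex.exp (-w * x) := by
    funext x
    have : -Complex.I * ((k : ℂ) - Complex.I * lam) = -w := by
      rw [hw]; linear_combination (lam : ℂ) * Complex.I_mul_I
    rw [this, ← sub_mul, ← Complex.ofReal_sub]
    rfl
  rw [hfun]
  refine ⟨c1.sub d1, ?_⟩
  rw [integral_sub c1 d1, c2, d2, add_assoc, ← hw]
  set s : ℂ := (1 + w) / 2 with hs
  have hsre : 0 < s.re := by
    have : s.re = (1 + lam) / 2 := by
      rw [hs, show (1 + w) / 2 = (1 + w) / ((2 : ℝ) : ℂ) by simp, Complex.div_ofReal_re]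
      simp [hre]
    rw [this]; linarith
  have hs0 : s ≠ 0 := by intro h; rw [h] at hsre; simp at hsre
  have hG : Gammaℝ s ≠ 0 := Gammaℝ_ne_zero_of_re_pos hsre
  have h1w : 1 + w = 2 * s := by rw [hs]; ring
  have h2w : 1 - w = 2 * (1 - s) := by rw [hs]; ring
  rw [← Gammaℝ_def, riemannZeta_def_of_ne_zero hs0, mul_div_cancel₀ _ hG,
    completedRiemannZeta_eq, h1w, h2w, one_div, one_div, mul_inv, mul_inv, one_div, one_div]
  ring
end

section
/- The Riemann hypothesis holds if and only if for every real k and every real λ with -1 < λ < 1 and λ ≠ 0, one has ∫_{-∞}^∞ R(x)·exp(-i·(k - iλ)·x) dx ≠ 0. -/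
open MeasureTheory Real Complex Set

open HurwitzZeta

/-- The theta part of the wave function. -/
noncomputable def thetaPart (x : ℝ) : ℝ :=
  2 * ∑' n : ℕ, Real.exp (|x| - π * ((n : ℝ) + 1) ^ 2 * Real.exp (4 * |x|))

lemma thetaPart_eq (x : ℝ) :
    thetaPart x = Real.exp |x| * (cosKernel 0 (Real.exp (4 * |x|)) - 1) := by
  have h := (hasSum_nat_cosKernel₀ 0 (Real.exp_pos (4 * |x|))).tsum_eq
  rw [QuotientAddGroup.mk_zero] at h
  rw [← h, thetaPart, ← tsum_mul_left, ← tsum_mul_left]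
  congr 1 with n
  rw [sub_eq_add_neg, Real.exp_add]
  simp only [mul_zero, zero_mul, Real.cos_zero, mul_one]
  rw [show -(π * ((n : ℝ) + 1) ^ 2 * Real.exp (4 * |x|))
    = -π * ((n : ℝ) + 1) ^ 2 * Real.exp (4 * |x|) by ring]
  ring

lemma modif_exp (x : ℝ) (hx : x ≠ 0) :
    (hurwitzEvenFEPair 0).f_modif (Real.exp (4 * x)) =
      ((Real.exp (-x) * thetaPart x : ℝ) : ℂ) := by
  rw [thetaPart_eq, WeakFEPair.f_modif, Pi.add_apply]
  rcases lt_or_gt_of_ne hx with h | h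
  · have h1 : Real.exp (4 * x) < 1 := by
      rw [Real.exp_lt_one_iff]; linarith
    rw [indicator_of_notMem (notMem_Ioi.mpr h1.le), zero_add,
      indicator_of_mem (mem_Ioo.mpr ⟨Real.exp_pos _, h1⟩), abs_of_neg h]
    have e1 : (hurwitzEvenFEPair 0).f (Real.exp (4 * x)) = (evenKernel 0 (Real.exp (4 * x)) : ℂ) :=
      rfl
    have e2 : (hurwitzEvenFEPair 0).ε = 1 := rfl
    have e3 : (hurwitzEvenFEPair 0).g₀ = 1 := rfl
    have e4 : (hurwitzEvenFEPair 0).k = 1 / 2 := rfl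
    rw [e1, e2, e3, e4, evenKernel_functional_equation]
    have e5 : Real.exp (4 * x) ^ (-(1 / 2) : ℝ) = Real.exp (-x) * Real.exp (-x) := by
      rw [← Real.exp_mul, ← Real.exp_add]; ring_nf
    have e6 : 1 / Real.exp (4 * x) ^ (1 / 2 : ℝ) = Real.exp (-x) * Real.exp (-x) := by
      rw [← e5, Real.rpow_neg (Real.exp_pos _).le, one_div]
    have e7 : 1 / Real.exp (4 * x) = Real.exp (4 * -x) := by
      rw [mul_neg, Real.exp_neg, one_div]
    rw [e5, e6, e7]
    push_cast
    simp only [smul_eq_mul]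
    ring
  · have h1 : 1 < Real.exp (4 * x) := by
      rw [Real.one_lt_exp_iff]; linarith
    rw [indicator_of_mem (mem_Ioi.mpr h1), indicator_of_notMem (notMem_Ioo_of_ge h1.le), add_zero,
      abs_of_pos h]
    have e1 : (hurwitzEvenFEPair 0).f (Real.exp (4 * x)) = (evenKernel 0 (Real.exp (4 * x)) : ℂ) :=
      rfl
    have e2 : (hurwitzEvenFEPair 0).f₀ = 1 := if_pos rfl
    rw [e1, e2, evenKernel_eq_cosKernel_of_zero, ← mul_assoc, ← Real.exp_add]
    simp

lemma exp_image : (fun x : ℝ => Real.exp (4 * x)) '' univ = Ioi 0 := by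
  ext y
  simp only [image_univ, mem_range, mem_Ioi]
  constructor
  · rintro ⟨x, rfl⟩; exact Real.exp_pos _
  · intro hy
    exact ⟨Real.log y / 4, by rw [mul_div_cancel₀ _ (by norm_num : (4 : ℝ) ≠ 0), Real.exp_log hy]⟩

lemma theta_transform (z : ℂ) :
    Integrable (fun x : ℝ => (thetaPart x : ℂ) * Complex.exp (-z * x)) ∧
    ∫ x : ℝ, (thetaPart x : ℂ) * Complex.exp (-z * x) =
      completedRiemannZeta₀ ((1 - z) / 2) / 2 := by
  set w : ℂ := (1 - z) / 4 with hw
  have hd : ∀ x ∈ (univ : Set ℝ), HasDerivWithinAt (fun x : ℝ => Real.exp (4 * x))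
      (Real.exp (4 * x) * 4) univ x := by
    intro x _
    have := ((hasDerivAt_id x).const_mul 4).exp
    exact HasDerivAt.hasDerivWithinAt (by simpa using this)
  have hinj : InjOn (fun x : ℝ => Real.exp (4 * x)) univ := by
    intro a _ b _ h
    have := Real.exp_injective h
    linarith
  have hM := ((hurwitzEvenFEPair 0).isStrongFEPair_toStrongFEPair.hasMellin w).1
  have hae : (fun x : ℝ => |Real.exp (4 * x) * 4| • (((Real.exp (4 * x) : ℝ) : ℂ) ^ (w - 1) •
      (hurwitzEvenFEPair 0).f_modif (Real.exp (4 * x)))) =ᵐ[volume]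
      fun x : ℝ => 4 * ((thetaPart x : ℂ) * Complex.exp (-z * x)) := by
    filter_upwards [compl_mem_ae_iff.mpr (Subsingleton.measure_zero (s := {(0 : ℝ)}) (by simp) _)]
      with x hx
    rw [modif_exp x hx, abs_of_pos (by positivity), Complex.cpow_def_of_ne_zero
      (by exact_mod_cast (Real.exp_pos _).ne'), ← Complex.ofReal_log (Real.exp_pos _).le,
      Real.log_exp, Complex.real_smul, smul_eq_mul]
    push_cast
    have : Complex.exp (-z * x) =
        Complex.exp (4 * x) * Complex.exp (4 * x * (w - 1)) * Complex.exp (-x) := by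
      rw [← Complex.exp_add, ← Complex.exp_add]
      congr 1
      rw [hw]; ring
    rw [this]
    ring
  constructor
  · have h1 : IntegrableOn (fun t : ℝ => (t : ℂ) ^ (w - 1) • (hurwitzEvenFEPair 0).f_modif t)
      (Ioi 0) := hM
    rw [← exp_image, integrableOn_image_iff_integrableOn_abs_deriv_smul MeasurableSet.univ hd hinj,
      integrableOn_univ, integrable_congr hae] at h1
    have := h1.const_mul (1 / 4)
    refine this.congr (Filter.Eventually.of_forall fun x => ?_)
    simp only
    ring
  · have h2 : completedRiemannZeta₀ ((1 - z) / 2) =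
        (∫ t in Ioi (0 : ℝ), (t : ℂ) ^ (w - 1) • (hurwitzEvenFEPair 0).f_modif t) / 2 := by
      change (hurwitzEvenFEPair 0).Λ₀ ((1 - z) / 2 / 2) / 2 = _
      rw [show (1 - z) / 2 / 2 = w by rw [hw]; ring]
      rfl
    rw [h2, ← exp_image, integral_image_eq_integral_abs_deriv_smul MeasurableSet.univ hd hinj,
      setIntegral_univ, integral_congr_ae hae, integral_const_mul]
    ring

lemma exp_transform (z : ℂ) (h1 : -1 < z.re) (h2 : z.re < 1) :
    Integrable (fun x : ℝ => (Real.exp (-|x|) : ℂ) * Complex.exp (-z * x)) ∧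
    ∫ x : ℝ, (Real.exp (-|x|) : ℂ) * Complex.exp (-z * x) = 1 / (1 - z) + 1 / (1 + z) := by
  have ha : 0 < (1 - z).re := by simp; linarith
  have hb : (-1 - z).re < 0 := by simp; linarith
  have ea : EqOn (fun x : ℝ => Complex.exp ((1 - z) * x))
      (fun x : ℝ => (Real.exp (-|x|) : ℂ) * Complex.exp (-z * x)) (Iic 0) := by
    intro x hx
    simp only
    rw [abs_of_nonpos hx]
    push_cast
    rw [← Complex.exp_add]
    congr 1; ring
  have eb : EqOn (fun x : ℝ => Complex.exp ((-1 - z) * x))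
      (fun x : ℝ => (Real.exp (-|x|) : ℂ) * Complex.exp (-z * x)) (Ioi 0) := by
    intro x hx
    simp only
    rw [abs_of_pos hx]
    push_cast
    rw [← Complex.exp_add]
    congr 1; ring
  have ia := (integrableOn_exp_mul_complex_Iic ha 0).congr_fun ea measurableSet_Iic
  have ib := (integrableOn_exp_mul_complex_Ioi hb 0).congr_fun eb measurableSet_Ioi
  constructor
  · rw [← integrableOn_univ, ← Iic_union_Ioi (a := (0 : ℝ))]
    exact ia.union ib
  · rw [← intervalIntegral.integral_Iic_add_Ioi ia ib,
      ← setIntegral_congr_fun measurableSet_Iic ea, ← setIntegral_congr_fun measurableSet_Ioi eb,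
      integral_exp_mul_complex_Iic ha, integral_exp_mul_complex_Ioi hb]
    simp only [ofReal_zero, mul_zero, Complex.exp_zero]
    rw [show -1 - z = -(1 + z) by ring, neg_div_neg_eq]

lemma wave_transform (z : ℂ) (h1 : -1 < z.re) (h2 : z.re < 1) :
    ∫ x : ℝ, (riemannWave x : ℂ) * Complex.exp (-z * x) =
      -completedRiemannZeta ((1 - z) / 2) / 2 := by
  obtain ⟨ie, he⟩ := exp_transform z h1 h2
  obtain ⟨it, ht⟩ := theta_transform z
  have : (fun x : ℝ => (riemannWave x : ℂ) * Complex.exp (-z * x)) = fun x : ℝ =>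
      (Real.exp (-|x|) : ℂ) * Complex.exp (-z * x) -
        (thetaPart x : ℂ) * Complex.exp (-z * x) := by
    ext x
    rw [← sub_mul, ← ofReal_sub]
    rfl
  rw [this, integral_sub ie it, he, ht, completedRiemannZeta_eq]
  have n1 : 1 - z ≠ 0 := fun h => by
    have := congrArg Complex.re h
    simp at this; linarith
  have n2 : 1 + z ≠ 0 := fun h => by
    have := congrArg Complex.re h
    simp at this; linarith
  rw [show 1 - (1 - z) / 2 = (1 + z) / 2 by ring]
  field_simp
  ring

lemma wave_ne (k lam : ℝ) (h1 : -1 < lam) (h2 : lam < 1) :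
    (∫ x : ℝ, (riemannWave x : ℂ) *
      Complex.exp (-Complex.I * ((k : ℂ) - Complex.I * lam) * x)) = 0 ↔
      riemannZeta ((1 - (lam + k * Complex.I)) / 2) = 0 := by
  have hz : -Complex.I * ((k : ℂ) - Complex.I * lam) = -(lam + k * Complex.I) := by
    linear_combination (lam : ℂ) * Complex.I_mul_I
  rw [hz, wave_transform _ (by simpa using h1) (by simpa using h2)]
  set s : ℂ := (1 - (lam + k * Complex.I)) / 2 with hs
  have hre : 0 < s.re := by
    have : s.re = (1 - lam) / 2 := by simp [hs]
    rw [this]; linarith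
  have s0 : s ≠ 0 := fun h => by simp [h] at hre
  rw [riemannZeta_def_of_ne_zero s0]
  simp [Gammaℝ_ne_zero_of_re_pos hre]

theorem stmt_5 :
    (∀ s : ℂ, riemannZeta s = 0 → 0 < s.re → s.re < 1 → s.re = 1 / 2) ↔
      (∀ k lam : ℝ, -1 < lam → lam < 1 → lam ≠ 0 →
        (∫ x : ℝ, (riemannWave x : ℂ) *
            Complex.exp (-Complex.I * ((k : ℂ) - Complex.I * lam) * x)) ≠ 0) := by
  constructor
  · intro H k lam h1 h2 h0 h
    rw [wave_ne k lam h1 h2] at h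
    have hr : ((1 - ((lam : ℂ) + k * Complex.I)) / 2).re = (1 - lam) / 2 := by simp
    have := H _ h (by rw [hr]; linarith) (by rw [hr]; linarith)
    rw [hr] at this
    exact h0 (by linarith)
  · intro H s hs h1 h2
    by_contra hne
    have g1 : -1 < 1 - 2 * s.re := by linarith
    have g2 : 1 - 2 * s.re < 1 := by linarith
    refine H (-2 * s.im) (1 - 2 * s.re) g1 g2 (fun h => hne (by linarith)) ?_
    rw [wave_ne _ _ g1 g2, ← hs]
    congr 1
    apply Complex.ext <;> simp <;> ring
end

section
/- ∑_{n=1}^∞ (1 − 4π n²)·exp(-π n²) = -1/2; equivalently, with θ(x) = ∑_{n=1}^∞ exp(-π n² x), one has 4·θ'(1) + θ(1) = -1/2. -/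
open Real

lemma aux_summable (c : ℝ) (hc : 0 < c) (k : ℕ) :
    Summable fun n : ℕ => ((n : ℝ) + 1) ^ k * Real.exp (-π * c * ((n : ℝ) + 1) ^ 2) := by
  have h := (summable_nat_add_iff 1).2
    (Real.summable_pow_mul_exp_neg_nat_mul k (r := π * c) (by positivity))
  refine Summable.of_nonneg_of_le (fun n => by positivity) (fun n => ?_) h
  push_cast
  have hn : (0 : ℝ) ≤ n := Nat.cast_nonneg n
  have hpc : 0 < π * c := by positivity
  gcongr ?_ * Real.exp ?_
  nlinarith [mul_nonneg hpc.le (mul_nonneg hn (by linarith : (0 : ℝ) ≤ n + 1))]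

lemma aux_int (x : ℝ) (hx : 0 < x) :
    ∑' n : ℤ, Real.exp (-π * x * (n : ℝ) ^ 2)
      = 1 + 2 * ∑' n : ℕ, Real.exp (-π * x * ((n : ℝ) + 1) ^ 2) := by
  have hs : Summable fun n : ℕ => Real.exp (-π * x * ((n : ℝ) + 1) ^ 2) := by
    simpa using aux_summable x hx 0
  have hs0 : Summable fun n : ℕ => Real.exp (-π * x * (n : ℝ) ^ 2) := by
    rw [← summable_nat_add_iff 1]
    simpa using hs
  have e : ∀ n : ℕ, Real.exp (-π * x * (((-((n : ℤ) + 1) : ℤ) : ℝ)) ^ 2)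
      = Real.exp (-π * x * ((n : ℝ) + 1) ^ 2) := by
    intro n; push_cast; congr 1; ring
  have h := HasSum.of_nat_of_neg_add_one (f := fun n : ℤ => Real.exp (-π * x * (n : ℝ) ^ 2))
    (m := ∑' n : ℕ, Real.exp (-π * x * (n : ℝ) ^ 2))
    (m' := ∑' n : ℕ, Real.exp (-π * x * ((n : ℝ) + 1) ^ 2))
    (by simpa using hs0.hasSum) (by simp only [e]; exact hs.hasSum)
  rw [h.tsum_eq, hs0.tsum_eq_zero_add]
  push_cast
  simp
  ring

lemma aux_deriv : HasDerivAt (fun x : ℝ => ∑' n : ℕ, Real.exp (-π * x * ((n : ℝ) + 1) ^ 2))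
    (∑' n : ℕ, (-π * ((n : ℝ) + 1) ^ 2) * Real.exp (-π * 1 * ((n : ℝ) + 1) ^ 2)) 1 := by
  refine hasDerivAt_tsum_of_isPreconnected
    (g := fun (n : ℕ) (x : ℝ) => Real.exp (-π * x * ((n : ℝ) + 1) ^ 2))
    (g' := fun (n : ℕ) (x : ℝ) => (-π * ((n : ℝ) + 1) ^ 2) * Real.exp (-π * x * ((n : ℝ) + 1) ^ 2))
    (t := Set.Ioi (1 / 2 : ℝ)) (y₀ := 1)
    ((aux_summable (1 / 2) (by norm_num) 2).mul_left π) isOpen_Ioi isPreconnected_Ioi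
    ?_ ?_ (by norm_num) (by simpa using aux_summable 1 one_pos 0) (by norm_num)
  · intro n y _
    have h := (((hasDerivAt_id y).const_mul (-π)).mul_const (((n : ℝ) + 1) ^ 2)).exp
    simp only [id, mul_one] at h
    rw [mul_comm]
    exact h
  · intro n y hy
    have hy' : (1 / 2 : ℝ) < y := hy
    rw [norm_mul, Real.norm_eq_abs, Real.norm_eq_abs, Real.abs_exp, neg_mul, abs_neg,
      abs_of_nonneg (by positivity), mul_assoc]
    have : 0 ≤ π * ((n : ℝ) + 1) ^ 2 := by positivity
    gcongr π * (_ * Real.exp ?_)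
    nlinarith

theorem stmt_7 :
    ∑' n : ℕ, (1 - 4 * π * ((n : ℝ) + 1) ^ 2) * Real.exp (-π * ((n : ℝ) + 1) ^ 2) = -(1 / 2) := by
  set S : ℝ → ℝ := fun x : ℝ => ∑' n : ℕ, Real.exp (-π * x * ((n : ℝ) + 1) ^ 2) with hS
  set D : ℝ := ∑' n : ℕ, (-π * ((n : ℝ) + 1) ^ 2) * Real.exp (-π * 1 * ((n : ℝ) + 1) ^ 2) with hD
  have hd : HasDerivAt S D 1 := aux_deriv
  have hfe : ∀ x : ℝ, 0 < x → 1 + 2 * S x = x ^ (-(1 / 2) : ℝ) * (1 + 2 * S x⁻¹) := by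
    intro x hx
    have h := Real.tsum_exp_neg_mul_int_sq hx
    rw [aux_int x hx] at h
    simp only [div_eq_mul_inv (-π) x] at h
    rw [aux_int x⁻¹ (inv_pos.2 hx)] at h
    rw [Real.rpow_neg hx.le, ← one_div]
    exact h
  have h1 : HasDerivAt (fun x => 1 + 2 * S x) (2 * D) 1 := (hd.const_mul 2).const_add 1
  have hinv : HasDerivAt (fun x : ℝ => x⁻¹) (-1) 1 := by
    simpa using hasDerivAt_inv (one_ne_zero (α := ℝ))
  have hd' : HasDerivAt S D ((1 : ℝ)⁻¹) := by simpa using hd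
  have h2 : HasDerivAt (fun x : ℝ => S x⁻¹) (D * (-1)) 1 := hd'.comp (1 : ℝ) hinv
  have h3 : HasDerivAt (fun x : ℝ => x ^ (-(1 / 2) : ℝ)) (-(1 / 2)) 1 := by
    simpa using Real.hasDerivAt_rpow_const (x := 1) (p := (-(1 / 2) : ℝ)) (Or.inl one_ne_zero)
  have h4 := h3.mul ((h2.const_mul 2).const_add 1)
  have h5 := h1.congr_of_eventuallyEq (f₁ := fun x : ℝ => x ^ (-(1 / 2) : ℝ) * (1 + 2 * S x⁻¹)) (by
    filter_upwards [lt_mem_nhds (one_pos (α := ℝ))] with x hx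
    exact (hfe x hx).symm)
  have h6 := h5.unique h4
  simp only [inv_one, Real.one_rpow] at h6
  have s0 : Summable fun n : ℕ => Real.exp (-π * 1 * ((n : ℝ) + 1) ^ 2) := by
    simpa using aux_summable 1 one_pos 0
  have s1 : Summable fun n : ℕ =>
      (-π * ((n : ℝ) + 1) ^ 2) * Real.exp (-π * 1 * ((n : ℝ) + 1) ^ 2) := by
    simpa [mul_assoc] using (aux_summable 1 one_pos 2).mul_left (-π)
  have h7 : ∑' n : ℕ, (1 - 4 * π * ((n : ℝ) + 1) ^ 2) * Real.exp (-π * ((n : ℝ) + 1) ^ 2)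
      = S 1 + 4 * D := by
    rw [hS, hD, ← tsum_mul_left, ← s0.tsum_add (s1.mul_left 4)]
    refine tsum_congr fun n => ?_
    rw [mul_one]
    ring
  rw [h7]
  linarith
end

section
/- The function R is differentiable at 0 with derivative 0; equivalently, the derivative of x ↦ exp(-x) − 2·∑_{n=1}^∞ exp(x − π n²·exp(4x)) at x = 0 vanishes, i.e. -1 − 2·∑_{n=1}^∞ (1 − 4π n²)·exp(-π n²) = 0. -/
open Real

lemma rw_summable {a : ℝ} (ha : 0 < a) :
    Summable fun n : ℕ => Real.exp (-π * a * ((n : ℝ) + 1) ^ 2) := by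
  have h0 : 0 < π * a := by positivity
  have h := (Real.summable_pow_mul_exp_neg_nat_mul 0 h0)
  refine Summable.of_nonneg_of_le (fun n => (Real.exp_pos _).le) (fun n => ?_) h
  have hn : (0 : ℝ) ≤ n := Nat.cast_nonneg n
  rw [pow_zero, one_mul, Real.exp_le_exp]
  have : (n : ℝ) ≤ ((n : ℝ) + 1) ^ 2 := by nlinarith
  nlinarith [mul_le_mul_of_nonneg_left this h0.le]

lemma rw_theta {a : ℝ} (ha : 0 < a) :
    ∑' n : ℤ, Real.exp (-π * a * (n : ℝ) ^ 2) =
      1 + 2 * ∑' n : ℕ, Real.exp (-π * a * ((n : ℝ) + 1) ^ 2) := by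
  have hs := rw_summable ha
  have e : ∀ n : ℕ, (-1 + -(n : ℝ)) ^ 2 = ((n : ℝ) + 1) ^ 2 := fun n => by ring
  have := tsum_of_add_one_of_neg_add_one (f := fun n : ℤ => Real.exp (-π * a * (n : ℝ) ^ 2))
    (by simpa using hs) (by simpa [e] using hs)
  rw [this]
  simp [e]
  ring

lemma rw_even (x : ℝ) :
    Real.exp (-x) - 2 * ∑' n : ℕ, Real.exp (x - π * ((n : ℝ) + 1) ^ 2 * Real.exp (4 * x)) =
    Real.exp (-(-x)) -
      2 * ∑' n : ℕ, Real.exp (-x - π * ((n : ℝ) + 1) ^ 2 * Real.exp (4 * (-x))) := by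
  have key : ∀ y : ℝ, ∑' n : ℕ, Real.exp (y - π * ((n : ℝ) + 1) ^ 2 * Real.exp (4 * y)) =
      Real.exp y * ∑' n : ℕ, Real.exp (-π * Real.exp (4 * y) * ((n : ℝ) + 1) ^ 2) := by
    intro y
    rw [← tsum_mul_left]
    refine tsum_congr fun n => ?_
    rw [← Real.exp_add]
    congr 1
    ring
  have h := Real.tsum_exp_neg_mul_int_sq (Real.exp_pos (4 * x))
  have e1 : -π / Real.exp (4 * x) = -π * Real.exp (4 * -x) := by
    rw [div_eq_mul_inv, ← Real.exp_neg]; congr 2; ring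
  have e2 : (1 : ℝ) / Real.exp (4 * x) ^ (1 / 2 : ℝ) = Real.exp (-x) * Real.exp (-x) := by
    rw [← Real.exp_mul, one_div, ← Real.exp_neg, ← Real.exp_add]; congr 1; ring
  rw [e1, e2, rw_theta (Real.exp_pos _), rw_theta (Real.exp_pos _)] at h
  rw [key, key, neg_neg]
  have h1 : Real.exp x * Real.exp (-x) = 1 := by rw [← Real.exp_add]; simp
  generalize ∑' n : ℕ, Real.exp (-π * Real.exp (4 * x) * ((n : ℝ) + 1) ^ 2) = A at *
  generalize ∑' n : ℕ, Real.exp (-π * Real.exp (4 * -x) * ((n : ℝ) + 1) ^ 2) = B at *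
  linear_combination (-Real.exp x) * h - (Real.exp (-x) * (1 + 2 * B)) * h1

lemma rw_deriv :
    HasDerivAt (fun x : ℝ => Real.exp (-x) -
        2 * ∑' n : ℕ, Real.exp (x - π * ((n : ℝ) + 1) ^ 2 * Real.exp (4 * x)))
      (-1 - 2 * ∑' n : ℕ,
        (1 - 4 * π * ((n : ℝ) + 1) ^ 2) * Real.exp (-π * ((n : ℝ) + 1) ^ 2)) 0 := by
  have hu : Summable fun n : ℕ =>
      (1 + 8 * π * ((n : ℝ) + 1) ^ 2) * (2 * Real.exp (-((n : ℝ) + 1))) := by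
    have h0 := (summable_nat_add_iff 1).2 (Real.summable_pow_mul_exp_neg_nat_mul 0 one_pos)
    have h2 := (summable_nat_add_iff 1).2 (Real.summable_pow_mul_exp_neg_nat_mul 2 one_pos)
    refine ((h0.mul_left 2).add (h2.mul_left (16 * π))).congr fun n => ?_
    push_cast
    rw [neg_one_mul]
    ring
  have hexp : Real.exp (1 / 2) < 2 := by
    have h := Real.exp_one_lt_d9
    have : Real.exp (1 / 2) * Real.exp (1 / 2) = Real.exp 1 := by
      rw [← Real.exp_add]; norm_num
    nlinarith [Real.exp_pos (1 / 2)]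
  have hD := hasDerivAt_tsum_of_isPreconnected (y₀ := (0 : ℝ)) (y := (0 : ℝ))
    (g := fun (n : ℕ) (x : ℝ) => Real.exp (x - π * ((n : ℝ) + 1) ^ 2 * Real.exp (4 * x)))
    (g' := fun (n : ℕ) (x : ℝ) => (1 - 4 * π * ((n : ℝ) + 1) ^ 2 * Real.exp (4 * x)) *
      Real.exp (x - π * ((n : ℝ) + 1) ^ 2 * Real.exp (4 * x)))
    hu (t := Set.Ioo (-1 / 8) (1 / 8)) isOpen_Ioo isPreconnected_Ioo ?_ ?_ (by norm_num) ?_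
    (by norm_num)
  · have h1 : HasDerivAt (fun x : ℝ => Real.exp (-x)) (-1) 0 := by
      simpa using (hasDerivAt_neg (0 : ℝ)).exp
    have h3 := h1.fun_sub (hD.const_mul 2)
    refine h3.congr_deriv ?_
    simp [neg_mul]
  · intro n y _
    have h4 : HasDerivAt (fun x : ℝ => Real.exp (4 * x)) (Real.exp (4 * y) * (4 * 1)) y :=
      ((hasDerivAt_id y).const_mul 4).exp
    refine ((hasDerivAt_id' y).fun_sub (h4.const_mul (π * ((n : ℝ) + 1) ^ 2))).exp.congr_deriv ?_
    ring
  · rintro n y ⟨hy1, hy2⟩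
    have hn : (0 : ℝ) ≤ n := Nat.cast_nonneg n
    have hE : Real.exp (4 * y) ≤ 2 :=
      (Real.exp_le_exp.2 (by linarith)).trans hexp.le
    have hE' : 1 / 2 ≤ Real.exp (4 * y) := by
      have := Real.add_one_le_exp (4 * y); linarith
    have hy : Real.exp y ≤ 2 := (Real.exp_le_exp.2 (by linarith)).trans hexp.le
    have hp := Real.pi_gt_three
    rw [norm_mul, Real.norm_of_nonneg (Real.exp_pos _).le]
    have hm : (0 : ℝ) ≤ π * ((n : ℝ) + 1) ^ 2 := by positivity
    refine mul_le_mul ?_ ?_ (Real.exp_pos _).le (by positivity)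
    · have ha := mul_le_mul_of_nonneg_left hE hm
      have hb := mul_nonneg hm (Real.exp_pos (4 * y)).le
      rw [Real.norm_eq_abs, abs_le]
      constructor <;> nlinarith
    · rw [sub_eq_add_neg, Real.exp_add]
      refine mul_le_mul hy (Real.exp_le_exp.2 ?_) (Real.exp_pos _).le (by norm_num)
      have ha := mul_le_mul_of_nonneg_left hE' hm
      have hc : (n : ℝ) + 1 ≤ ((n : ℝ) + 1) ^ 2 := by nlinarith
      have hd : 3 * ((n : ℝ) + 1) ^ 2 ≤ π * ((n : ℝ) + 1) ^ 2 :=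
        mul_le_mul_of_nonneg_right hp.le (by positivity)
      linarith
  · simpa using rw_summable one_pos

theorem stmt_9 :
    HasDerivAt riemannWave 0 0 ∧
    HasDerivAt (fun x : ℝ => Real.exp (-x) -
        2 * ∑' n : ℕ, Real.exp (x - π * ((n : ℝ) + 1) ^ 2 * Real.exp (4 * x))) 0 0 ∧
    -1 - 2 * ∑' n : ℕ,
        (1 - 4 * π * ((n : ℝ) + 1) ^ 2) * Real.exp (-π * ((n : ℝ) + 1) ^ 2) = 0 := by
  have hd := rw_deriv
  have hz : -1 - 2 * ∑' n : ℕ,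
        (1 - 4 * π * ((n : ℝ) + 1) ^ 2) * Real.exp (-π * ((n : ℝ) + 1) ^ 2) = 0 := by
    have h2 := deriv_comp_neg (𝕜 := ℝ) (F := ℝ) (fun x : ℝ => Real.exp (-x) -
        2 * ∑' n : ℕ, Real.exp (x - π * ((n : ℝ) + 1) ^ 2 * Real.exp (4 * x))) 0
    simp only [← rw_even] at h2
    rw [neg_zero, hd.deriv] at h2
    linarith
  rw [hz] at hd
  refine ⟨?_, hd, hz⟩
  have : riemannWave = fun x : ℝ => Real.exp (-x) -
        2 * ∑' n : ℕ, Real.exp (x - π * ((n : ℝ) + 1) ^ 2 * Real.exp (4 * x)) := by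
    funext x
    unfold riemannWave
    rcases abs_choice x with h | h <;> rw [h]
    exact (rw_even x).symm
  rw [this]
  exact hd
end

section
/- For every real x, one has |R(x)| < exp(-|x|). -/
open Real

theorem stmt_10 (x : ℝ) : |riemannWave x| < Real.exp (-|x|) := by
  unfold riemannWave
  have ha : 0 ≤ |x| := abs_nonneg x
  generalize |x| = a at ha ⊢
  have hle : ∀ n : ℕ, Real.exp (a - π * ((n : ℝ) + 1) ^ 2 * Real.exp (4 * a))
      ≤ Real.exp (-a) * (1 / 4) * (1 / 4 : ℝ) ^ n := by
    intro n
    have hn : (0 : ℝ) ≤ n := Nat.cast_nonneg n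
    have h3 : Real.exp (-3) ≤ 1 / 4 := by
      rw [Real.exp_neg, one_div]
      apply inv_anti₀ (by norm_num)
      have := Real.add_one_le_exp (3 : ℝ)
      linarith
    have hpi := Real.pi_gt_three
    have hu := Real.add_one_le_exp (4 * a)
    have h1 : 3 * ((n : ℝ) + 1) ≤ π * ((n : ℝ) + 1) ^ 2 := by
      have : (n : ℝ) + 1 ≤ ((n : ℝ) + 1) ^ 2 := by nlinarith
      nlinarith
    have h2 : 3 * ((n : ℝ) + 1) * (4 * a + 1) ≤ π * ((n : ℝ) + 1) ^ 2 * Real.exp (4 * a) :=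
      mul_le_mul h1 hu (by linarith) (by positivity)
    have h4 : 0 ≤ (n : ℝ) * a := mul_nonneg hn ha
    calc Real.exp (a - π * ((n : ℝ) + 1) ^ 2 * Real.exp (4 * a))
        ≤ Real.exp (-a + ((n + 1 : ℕ) : ℝ) * (-3)) := by
          apply Real.exp_le_exp.mpr
          push_cast
          nlinarith
      _ = Real.exp (-a) * Real.exp (-3) ^ (n + 1) := by
          rw [Real.exp_add, Real.exp_nat_mul]
      _ ≤ Real.exp (-a) * (1 / 4) ^ (n + 1) := by gcongr
      _ = _ := by ring
  have hg : HasSum (fun n : ℕ => Real.exp (-a) * (1 / 4) * (1 / 4 : ℝ) ^ n)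
      (Real.exp (-a) * (1 / 4) * (1 - 1 / 4)⁻¹) :=
    (hasSum_geometric_of_lt_one (by norm_num) (by norm_num)).mul_left _
  have hs : Summable (fun n : ℕ => Real.exp (a - π * ((n : ℝ) + 1) ^ 2 * Real.exp (4 * a))) :=
    Summable.of_nonneg_of_le (fun n => (Real.exp_pos _).le) hle hg.summable
  have hub := hasSum_le hle hs.hasSum hg
  have hpos := hs.tsum_pos (fun n => (Real.exp_pos _).le) 0 (Real.exp_pos _)
  have he := Real.exp_pos (-a)
  rw [abs_lt]
  constructor
  · norm_num at hub
    linarith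
  · linarith
end
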